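/- Let s₁ < s₂ < s₃ be positive integers with s₃ = s₁ + s₂, let j be the unique integer with 0 ≤ j < 2s₁ and s₂ − s₁ ≡ j (mod 2s₁), and suppose s₁ ≤ j < 2s₁. Then the eventual period p of the nim sequence of the subtraction game S(s₁, s₂, s₃) equals s₁ · (s₂ + s₃ + j − 2s₁) / gcd(s₁, 2s₁ − j). -/

import Mathlib

/-- The Grundy (nim-value) function of the subtraction game with subtraction
set `S` (a finite set of positive integers):
`G(h) = mex { G(h - s) : s ∈ S, s ≤ h }`, where `mex` is realized as `sInf`
of the complement.  (The positivity condition in the filter is vacuous for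
sets of positive integers and serves to make the recursion well-founded.) -/
noncomputable def grundy (S : Finset ℕ) : ℕ → ℕ
  | h => sInf {n : ℕ | n ∉ ((S.filter (fun s => 0 < s ∧ s ≤ h)).attach.image
      (fun s => grundy S (h - s.1)))}
  decreasing_by
    have := Finset.mem_filter.mp s.2
    omega

/-- `p` is the eventual period of the nim sequence of the subtraction game
with subtraction set `S`: the least positive `p` such that for some `N`,
`G(h + p) = G(h)` for all `h ≥ N`. -/
def IsEventualPeriod (S : Finset ℕ) (p : ℕ) : Prop :=
  IsLeast {q : ℕ | 0 < q ∧ ∃ N : ℕ, ∀ h ≥ N, grundy S (h + q) = grundy S h} p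

def cc (s r n a : ℤ) : ℤ := (a + r * n) % s
def al (s r n a : ℤ) : ℤ := (cc s r n a + r) / s
def TT (s r q k a : ℤ) : ℤ := 2 * cc s r (2 * k) a + k * ((4 * q + 7) * s - 3 * r) - cc s r k a
def UU (s r q k a : ℤ) : ℤ :=
  2 * cc s r (2 * k + 1) a + (k + 1) * ((4 * q + 7) * s - 3 * r) - cc s r k a - ((2 * q + 3) * s - r)
def LL (s r q k a : ℤ) : ℤ := 2 * (q + 2 - al s r (2 * k) a)
def HH (s r q k a : ℤ) : ℤ := 2 * q + 3 - 2 * al s r (2 * k + 1) a + al s r k a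

def Low (s r q k i x : ℤ) : Prop := x = TT s r q k x + i * s ∧ 0 ≤ i ∧ i < LL s r q k x
def High (s r q k i x : ℤ) : Prop := x = UU s r q k x + i * s ∧ 0 ≤ i ∧ i < HH s r q k x

section
variable {s r q : ℤ}

theorem cc_bd (hs : 0 < s) (n a : ℤ) : 0 ≤ cc s r n a ∧ cc s r n a < s :=
  ⟨Int.emod_nonneg _ hs.ne', Int.emod_lt_of_pos _ hs⟩

theorem al_bd (hs : 0 < s) (hr : 0 < r) (hrs : r ≤ s) (n a : ℤ) : al s r n a = 0 ∨ al s r n a = 1 := by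
  have h := cc_bd (r := r) hs n a
  have h1 : 0 ≤ al s r n a := Int.ediv_nonneg (by omega) hs.le
  have h2 : al s r n a < 2 := Int.ediv_lt_of_lt_mul hs (by omega)
  omega

theorem cc_succ (n a : ℤ) : cc s r (n + 1) a = cc s r n a + r - s * al s r n a := by
  have h : cc s r (n + 1) a = (cc s r n a + r) % s := by
    unfold cc
    rw [Int.emod_add_emod]
    ring_nf
  rw [h, Int.emod_def]; rfl

theorem cc_sub1 (n a : ℤ) : cc s r n (a - s) = cc s r n a := by
  unfold cc
  rw [show a - s + r * n = a + r * n - s by ring, Int.sub_emod_right]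

theorem cc_sub2 (n a : ℤ) : cc s r n (a - ((2 * q + 3) * s - r)) = cc s r (n + 1) a := by
  unfold cc
  rw [show a - ((2 * q + 3) * s - r) + r * n = a + r * (n + 1) - s * (2 * q + 3) by ring,
    Int.sub_mul_emod_self_left]

theorem al_sub1 (n a : ℤ) : al s r n (a - s) = al s r n a := by
  unfold al; rw [cc_sub1]

theorem al_sub2 (n a : ℤ) : al s r n (a - ((2 * q + 3) * s - r)) = al s r (n + 1) a := by
  unfold al; rw [cc_sub2]

theorem UU_eq (k a : ℤ) : UU s r q k a = TT s r q k a + LL s r q k a * s := by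
  unfold UU TT LL
  rw [cc_succ]; ring

theorem TT_eq (k a : ℤ) : TT s r q (k + 1) a = UU s r q k a + HH s r q k a * s := by
  unfold UU TT HH
  rw [show 2 * (k + 1) = (2 * k + 1) + 1 by ring, cc_succ, cc_succ k]; ring

theorem TT_sub1 (k a : ℤ) : TT s r q k (a - s) = TT s r q k a := by
  unfold TT; simp only [cc_sub1]
theorem UU_sub1 (k a : ℤ) : UU s r q k (a - s) = UU s r q k a := by
  unfold UU; simp only [cc_sub1]
theorem LL_sub1 (k a : ℤ) : LL s r q k (a - s) = LL s r q k a := by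
  unfold LL; simp only [al_sub1]
theorem HH_sub1 (k a : ℤ) : HH s r q k (a - s) = HH s r q k a := by
  unfold HH; simp only [al_sub1]

/-- starts of high blocks in the chain of `x - s₂` -/
theorem UU_sub2 (k a : ℤ) :
    UU s r q (k - 1) (a - ((2 * q + 3) * s - r)) = TT s r q k a - ((2 * q + 3) * s - r) := by
  unfold TT UU; simp only [cc_sub2]
  rw [show 2 * (k - 1) + 1 + 1 = 2 * k by ring, show k - 1 + 1 = k by ring]

theorem HH_sub2 (k a : ℤ) :
    HH s r q (k - 1) (a - ((2 * q + 3) * s - r)) = 2 * q + 3 - 2 * al s r (2 * k) a + al s r k a := by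
  unfold HH; simp only [al_sub2]
  rw [show 2 * (k - 1) + 1 + 1 = 2 * k by ring, show k - 1 + 1 = k by ring]

theorem TT_sub2 (k a : ℤ) :
    TT s r q k (a - ((2 * q + 3) * s - r)) =
      UU s r q k a - ((2 * q + 3) * s - r) - (1 - al s r k a) * s := by
  unfold TT UU; simp only [cc_sub2]
  rw [cc_succ k]; ring

theorem LL_sub2 (k a : ℤ) :
    LL s r q k (a - ((2 * q + 3) * s - r)) = 2 * (q + 2 - al s r (2 * k + 1) a) := by
  unfold LL; simp only [al_sub2]

theorem LL_bd (hs : 0 < s) (hr : 0 < r) (hrs : r ≤ s) (hq : 0 ≤ q) (k a : ℤ) : 2 ≤ LL s r q k a := by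
  unfold LL; have := al_bd hs hr hrs (2 * k) a; omega

theorem HH_bd (hs : 0 < s) (hr : 0 < r) (hrs : r ≤ s) (hq : 0 ≤ q) (k a : ℤ) : 1 ≤ HH s r q k a := by
  unfold HH; have := al_bd hs hr hrs (2 * k + 1) a; have := al_bd hs hr hrs k a; omega

theorem low_pred {k i x : ℤ} (h : Low s r q k i x) (hi : 1 ≤ i) : Low s r q k (i - 1) (x - s) := by
  obtain ⟨h1, h2, h3⟩ := h
  refine ⟨?_, by omega, by rw [LL_sub1]; omega⟩
  rw [TT_sub1]; linarith

theorem high_pred {k i x : ℤ} (h : High s r q k i x) (hi : 1 ≤ i) : High s r q k (i - 1) (x - s) := by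
  obtain ⟨h1, h2, h3⟩ := h
  refine ⟨?_, by omega, by rw [HH_sub1]; omega⟩
  rw [UU_sub1]; linarith

theorem low_zero_pred (hs : 0 < s) (hr : 0 < r) (hrs : r ≤ s) (hq : 0 ≤ q) {k x : ℤ}
    (h : Low s r q k 0 x) : High s r q (k - 1) (HH s r q (k - 1) x - 1) (x - s) := by
  obtain ⟨h1, h2, h3⟩ := h
  have := HH_bd hs hr hrs hq (k - 1) x
  refine ⟨?_, by omega, by rw [HH_sub1]; omega⟩
  have h4 := TT_eq (s := s) (r := r) (q := q) (k - 1) x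
  rw [show k - 1 + 1 = k by ring] at h4
  rw [UU_sub1]; linarith

theorem high_zero_pred (hs : 0 < s) (hr : 0 < r) (hrs : r ≤ s) (hq : 0 ≤ q) {k x : ℤ}
    (h : High s r q k 0 x) : Low s r q k (LL s r q k x - 1) (x - s) := by
  obtain ⟨h1, h2, h3⟩ := h
  have := LL_bd hs hr hrs hq k x
  refine ⟨?_, by omega, by rw [LL_sub1]; omega⟩
  have h4 := UU_eq (s := s) (r := r) (q := q) k x
  rw [TT_sub1]; linarith

theorem low_s2 {k i x : ℤ} (h : Low s r q k i x)
    (hi : i < 2 * q + 3 - 2 * al s r (2 * k) x + al s r k x) :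
    High s r q (k - 1) i (x - ((2 * q + 3) * s - r)) := by
  obtain ⟨h1, h2, h3⟩ := h
  refine ⟨?_, h2, by rw [HH_sub2]; omega⟩
  rw [UU_sub2]; linarith

theorem low_s2' (hs : 0 < s) (hr : 0 < r) (hrs : r ≤ s) (hq : 0 ≤ q) {k i x : ℤ}
    (h : Low s r q k i x)
    (hi : i = 2 * q + 3 - 2 * al s r (2 * k) x + al s r k x) :
    Low s r q k 0 (x - ((2 * q + 3) * s - r)) := by
  obtain ⟨h1, h2, h3⟩ := h
  have := LL_bd hs hr hrs hq k (x - ((2 * q + 3) * s - r))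
  refine ⟨?_, le_rfl, by omega⟩
  have h4 := TT_eq (s := s) (r := r) (q := q) (k - 1) (x - ((2 * q + 3) * s - r))
  rw [show k - 1 + 1 = k by ring, UU_sub2, HH_sub2, ← hi] at h4
  linarith

theorem high_s2 (hs : 0 < s) (hr : 0 < r) (hrs : r ≤ s) {k i x : ℤ} (h : High s r q k i x) :
    Low s r q k (i + 1 - al s r k x) (x - ((2 * q + 3) * s - r)) := by
  obtain ⟨h1, h2, h3⟩ := h
  have := al_bd hs hr hrs k x
  refine ⟨?_, by omega, by rw [LL_sub2]; unfold HH at h3; omega⟩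
  rw [TT_sub2]; linarith

theorem TT_zero (hs : 0 < s) (x : ℤ) : 0 ≤ TT s r q 0 x ∧ TT s r q 0 x < s := by
  have := cc_bd (r := r) hs 0 x
  unfold TT; simp only [mul_zero, zero_mul]; omega

theorem TT_mono (hs : 0 < s) (hr : 0 < r) (hrs : r ≤ s) (hq : 0 ≤ q) (k : ℤ) (hk : 0 ≤ k) (x : ℤ) :
    0 ≤ TT s r q k x := by
  induction k, hk using Int.le_induction with
  | base => exact (TT_zero hs x).1
  | succ k hk ih =>
    rw [TT_eq, UU_eq]
    have := LL_bd hs hr hrs hq k x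
    have := HH_bd hs hr hrs hq k x
    positivity

theorem low_nonneg (hs : 0 < s) (hr : 0 < r) (hrs : r ≤ s) (hq : 0 ≤ q) {k i x : ℤ} (hk : 0 ≤ k)
    (h : Low s r q k i x) : 0 ≤ x := by
  obtain ⟨h1, h2, h3⟩ := h
  rw [h1]
  have := TT_mono hs hr hrs hq k hk x
  positivity

theorem high_nonneg (hs : 0 < s) (hr : 0 < r) (hrs : r ≤ s) (hq : 0 ≤ q) {k i x : ℤ} (hk : 0 ≤ k)
    (h : High s r q k i x) : 0 ≤ x := by
  obtain ⟨h1, h2, h3⟩ := h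
  rw [h1, UU_eq]
  have := TT_mono hs hr hrs hq k hk x
  have := LL_bd hs hr hrs hq k x
  positivity

theorem high_neg (hs : 0 < s) {i x : ℤ} (h : High s r q (-1) i x) : x < 0 := by
  obtain ⟨h1, h2, h3⟩ := h
  have h4 := TT_eq (s := s) (r := r) (q := q) (-1) x
  rw [show (-1 : ℤ) + 1 = 0 by ring] at h4
  have := TT_zero (r := r) (q := q) hs x
  nlinarith

theorem low_neg (hs : 0 < s) (hr : 0 < r) (hrs : r ≤ s) (hq : 0 ≤ q) {x : ℤ} (h : Low s r q 0 0 x) :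
    x < s := by
  obtain ⟨h1, h2, h3⟩ := h
  have := TT_zero (r := r) (q := q) hs x
  omega

theorem exists_block (hs : 0 < s) (hr : 0 < r) (hrs : r ≤ s) (hq : 0 ≤ q) (N : ℕ) :
    ∀ x : ℤ, 0 ≤ x → x < N → ∃ k i, 0 ≤ k ∧ (Low s r q k i x ∨ High s r q k i x) := by
  induction N with
  | zero => intro x h1 h2; simp at h2; omega
  | succ N ih =>
    intro x h1 h2
    push_cast at h2
    by_cases hx : x < s
    · refine ⟨0, 0, le_rfl, Or.inl ⟨?_, le_rfl, ?_⟩⟩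
      · unfold TT cc; simp only [mul_zero, zero_mul, add_zero]
        rw [Int.emod_eq_of_lt h1 hx]; omega
      · have := LL_bd hs hr hrs hq 0 x; omega
    · obtain ⟨k, i, hk, h | h⟩ := ih (x - s) (by omega) (by omega)
      · obtain ⟨h3, h4, h5⟩ := h
        rw [TT_sub1] at h3; rw [LL_sub1] at h5
        by_cases hi : i + 1 < LL s r q k x
        · exact ⟨k, i + 1, hk, Or.inl ⟨by linarith, by omega, hi⟩⟩
        · refine ⟨k, 0, hk, Or.inr ⟨?_, by omega, ?_⟩⟩
          · rw [UU_eq, show LL s r q k x = i + 1 by omega]; linarith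
          · have := HH_bd hs hr hrs hq k x; omega
      · obtain ⟨h3, h4, h5⟩ := h
        rw [UU_sub1] at h3; rw [HH_sub1] at h5
        by_cases hi : i + 1 < HH s r q k x
        · exact ⟨k, i + 1, hk, Or.inr ⟨by linarith, by omega, hi⟩⟩
        · refine ⟨k + 1, 0, by omega, Or.inl ⟨?_, by omega, ?_⟩⟩
          · rw [TT_eq, show HH s r q k x = i + 1 by omega]; linarith
          · have := LL_bd hs hr hrs hq (k + 1) x; omega

/-- the defining property of the Grundy function -/
def MexProp (s r q : ℤ) (g : ℤ → ℤ) : Prop :=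
  ∀ x v : ℤ, 0 ≤ x → 0 ≤ v →
    (0 ≤ x - s → g (x - s) ≠ v) →
    (0 ≤ x - ((2 * q + 3) * s - r) → g (x - ((2 * q + 3) * s - r)) ≠ v) →
    (0 ≤ x - ((2 * q + 3) * s - r) - s → g (x - ((2 * q + 3) * s - r) - s) ≠ v) →
    (∀ w, 0 ≤ w → w < v → (0 ≤ x - s ∧ g (x - s) = w) ∨
      (0 ≤ x - ((2 * q + 3) * s - r) ∧ g (x - ((2 * q + 3) * s - r)) = w) ∨
      (0 ≤ x - ((2 * q + 3) * s - r) - s ∧ g (x - ((2 * q + 3) * s - r) - s) = w)) →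
    g x = v

theorem main_val (hs : 0 < s) (hr : 0 < r) (hrs : r ≤ s) (hq : 0 ≤ q) {g : ℤ → ℤ}
    (hg : MexProp s r q g) (N : ℕ) :
    ∀ x : ℤ, x < N → ∀ k i, 0 ≤ k → (Low s r q k i x → g x = i % 2) ∧
      (High s r q k i x → g x = 2 + i % 2) := by
  induction N with
  | zero =>
    intro x h1 k i hk
    simp at h1
    constructor
    · intro h; have := low_nonneg hs hr hrs hq hk h; omega
    · intro h; have := high_nonneg hs hr hrs hq hk h; omega
  | succ N ih =>
    intro x hx k i hk
    push_cast at hx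
    have hs2 : 0 < (2 * q + 3) * s - r := by nlinarith
    have hm : ∀ y, y < x → y < N := by intro y hy; omega
    have e1 := hm (x - s) (by omega)
    have e2 := hm (x - ((2 * q + 3) * s - r)) (by omega)
    have e3 := hm (x - ((2 * q + 3) * s - r) - s) (by omega)
    have a1 := al_bd hs hr hrs (2 * k) x
    have a2 := al_bd hs hr hrs (2 * k + 1) x
    have a3 := al_bd hs hr hrs k x
    constructor
    · intro h
      have hx0 := low_nonneg hs hr hrs hq hk h
      have hL := h.2.2
      have hi0 := h.2.1
      unfold LL at hL
      -- previous element
      have p1 : 1 ≤ i → 0 ≤ x - s ∧ g (x - s) = (i - 1) % 2 := fun hi =>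
        ⟨low_nonneg hs hr hrs hq hk (low_pred h hi), (ih _ e1 k _ hk).1 (low_pred h hi)⟩
      have p2 : i = 0 → 0 ≤ x - s → 2 ≤ g (x - s) := by
        intro hi hxs
        subst hi
        have hh := low_zero_pred hs hr hrs hq h
        by_cases hk0 : k = 0
        · subst hk0; have := low_neg hs hr hrs hq h; omega
        · have := (ih _ e1 (k - 1) _ (by omega)).2 hh
          omega
      have p3 : i < 2 * q + 3 - 2 * al s r (2 * k) x + al s r k x →
          0 ≤ x - ((2 * q + 3) * s - r) → 2 ≤ g (x - ((2 * q + 3) * s - r)) := by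
        intro hi hxs
        have hh := low_s2 h hi
        by_cases hk0 : k = 0
        · subst hk0; have := high_neg hs hh; omega
        · have := (ih _ e2 (k - 1) _ (by omega)).2 hh
          omega
      have p4 : i = 2 * q + 3 - 2 * al s r (2 * k) x + al s r k x →
          g (x - ((2 * q + 3) * s - r)) = 0 := by
        intro hi
        have := (ih _ e2 k _ hk).1 (low_s2' hs hr hrs hq h hi)
        omega
      have p5 : 1 ≤ i → 0 ≤ x - ((2 * q + 3) * s - r) - s →
          2 ≤ g (x - ((2 * q + 3) * s - r) - s) := by
        intro hi hxs
        have hh := low_s2 (low_pred h hi) (by rw [al_sub1, al_sub1]; omega)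
        rw [sub_right_comm] at hh
        by_cases hk0 : k = 0
        · subst hk0; have := high_neg hs hh; omega
        · have := (ih _ e3 (k - 1) _ (by omega)).2 hh
          omega
      have p6 : i = 0 → 0 ≤ x - ((2 * q + 3) * s - r) - s →
          g (x - ((2 * q + 3) * s - r) - s) = 1 := by
        intro hi hxs
        subst hi
        have hh := low_s2 h (by omega)
        by_cases hk0 : k = 0
        · subst hk0; have := high_neg hs hh; omega
        · have := (ih _ e3 (k - 1) _ (by omega)).1 (high_zero_pred hs hr hrs hq hh)
          rw [this]; unfold LL; omega
      apply hg x _ hx0 (by omega)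
      · intro hxs; by_cases hi : i = 0
        · have := p2 hi hxs; omega
        · have := p1 (by omega); omega
      · intro hxs
        by_cases hi : i < 2 * q + 3 - 2 * al s r (2 * k) x + al s r k x
        · have := p3 hi hxs; omega
        · have := p4 (by omega); omega
      · intro hxs; by_cases hi : i = 0
        · have := p6 hi hxs; omega
        · have := p5 (by omega) hxs; omega
      · intro w hw hw2
        left
        have := p1 (by omega); omega
    · intro h
      have hx0 := high_nonneg hs hr hrs hq hk h
      have hL := h.2.2
      have hi0 := h.2.1
      unfold HH at hL
      have p1 : 1 ≤ i → g (x - s) = 2 + (i - 1) % 2 := fun hi =>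
        (ih _ e1 k _ hk).2 (high_pred h hi)
      have p2 : i = 0 → g (x - s) = 1 := by
        intro hi
        subst hi
        have := (ih _ e1 k _ hk).1 (high_zero_pred hs hr hrs hq h)
        rw [this]; unfold LL; omega
      have p0 : 0 ≤ x - s := by
        by_cases hi : i = 0
        · subst hi; exact low_nonneg hs hr hrs hq hk (high_zero_pred hs hr hrs hq h)
        · exact high_nonneg hs hr hrs hq hk (high_pred h (by omega))
      have hl := high_s2 hs hr hrs h
      have p3 := (ih _ e2 k _ hk).1 hl
      have p3' := low_nonneg hs hr hrs hq hk hl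
      have p4 : 1 ≤ i + 1 - al s r k x → 0 ≤ x - ((2 * q + 3) * s - r) - s ∧
          g (x - ((2 * q + 3) * s - r) - s) = (i - al s r k x) % 2 := by
        intro hi
        have hh := low_pred hl hi
        have := (ih _ e3 k _ hk).1 hh
        exact ⟨low_nonneg hs hr hrs hq hk hh, by omega⟩
      have p5 : i + 1 - al s r k x = 0 → 0 ≤ x - ((2 * q + 3) * s - r) - s →
          g (x - ((2 * q + 3) * s - r) - s) = 3 := by
        intro hi hxs
        rw [hi] at hl
        have hh := low_zero_pred hs hr hrs hq hl
        by_cases hk0 : k = 0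
        · subst hk0; have := high_neg hs hh; omega
        · have := (ih _ e3 (k - 1) _ (by omega)).2 hh
          rw [HH_sub2] at this
          rw [this]; omega
      apply hg x _ hx0 (by omega)
      · intro hxs; by_cases hi : i = 0
        · have := p2 hi; omega
        · have := p1 (by omega); omega
      · intro hxs; omega
      · intro hxs
        by_cases hi : 1 ≤ i + 1 - al s r k x
        · have := p4 hi; omega
        · have := p5 (by omega) hxs; omega
      · intro w hw hw2
        by_cases hi : 1 ≤ i + 1 - al s r k x
        · have := p4 hi
          by_cases hi0 : i = 0
          · have := p2 hi0; omega
          · have := p1 (by omega); omega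
        · have := p2 (by omega); omega

theorem val_low (hs : 0 < s) (hr : 0 < r) (hrs : r ≤ s) (hq : 0 ≤ q) {g : ℤ → ℤ}
    (hg : MexProp s r q g) {x k i : ℤ} (hk : 0 ≤ k) (h : Low s r q k i x) : g x = i % 2 :=
  (main_val hs hr hrs hq hg (x.toNat + 1) x (by push_cast; omega) k i hk).1 h

theorem val_high (hs : 0 < s) (hr : 0 < r) (hrs : r ≤ s) (hq : 0 ≤ q) {g : ℤ → ℤ}
    (hg : MexProp s r q g) {x k i : ℤ} (hk : 0 ≤ k) (h : High s r q k i x) : g x = 2 + i % 2 :=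
  (main_val hs hr hrs hq hg (x.toNat + 1) x (by push_cast; omega) k i hk).2 h

theorem ex_block (hs : 0 < s) (hr : 0 < r) (hrs : r ≤ s) (hq : 0 ≤ q) {x : ℤ} (hx : 0 ≤ x) :
    ∃ k i, 0 ≤ k ∧ (Low s r q k i x ∨ High s r q k i x) :=
  exists_block hs hr hrs hq (x.toNat + 1) x hx (by push_cast; omega)

theorem cc_addz (n a z : ℤ) : cc s r n (a + z * s) = cc s r n a := by
  unfold cc
  rw [show a + z * s + r * n = a + r * n + s * z by ring, Int.add_mul_emod_self_left]

theorem TT_addz (n a z : ℤ) : TT s r q n (a + z * s) = TT s r q n a := by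
  unfold TT; simp only [cc_addz]
theorem UU_addz (n a z : ℤ) : UU s r q n (a + z * s) = UU s r q n a := by
  unfold UU; simp only [cc_addz]
theorem LL_addz (n a z : ℤ) : LL s r q n (a + z * s) = LL s r q n a := by
  unfold LL al; simp only [cc_addz]
theorem HH_addz (n a z : ℤ) : HH s r q n (a + z * s) = HH s r q n a := by
  unfold HH al; simp only [cc_addz]

theorem low_mk {k a z i : ℤ} (h : TT s r q k a = a + z * s) (hi : 0 ≤ i) (hi2 : i < LL s r q k a) :
    Low s r q k i (a + (z + i) * s) := by
  refine ⟨?_, hi, by rw [LL_addz]; exact hi2⟩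
  rw [TT_addz, h]; ring

theorem high_mk {k a z i : ℤ} (h : UU s r q k a = a + z * s) (hi : 0 ≤ i) (hi2 : i < HH s r q k a) :
    High s r q k i (a + (z + i) * s) := by
  refine ⟨?_, hi, by rw [HH_addz]; exact hi2⟩
  rw [UU_addz, h]; ring

theorem LL_le (hs : 0 < s) (hr : 0 < r) (hrs : r ≤ s) (hq : 0 ≤ q) {g : ℤ → ℤ}
    (hg : MexProp s r q g) {a b k l z : ℤ} (hk : 0 ≤ k) (hl : 0 ≤ l)
    (heq : ∀ i, 0 ≤ i → g (a + (z + i) * s) = g (b + (z + i) * s))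
    (ha : TT s r q k a = a + z * s) (hb : TT s r q l b = b + z * s) :
    LL s r q k a ≤ LL s r q l b := by
  by_contra hc
  push Not at hc
  have h0 := LL_bd hs hr hrs hq l b
  have h1 := val_low hs hr hrs hq hg hk (low_mk ha (by omega : 0 ≤ LL s r q l b) hc)
  have hu : UU s r q l b = b + (z + LL s r q l b) * s := by rw [UU_eq, hb]; ring
  have h2 := val_high hs hr hrs hq hg hl (high_mk hu le_rfl (by have := HH_bd hs hr hrs hq l b; omega))
  have h3 := heq (LL s r q l b) (by omega)
  rw [add_zero] at h2
  omega

theorem HH_le (hs : 0 < s) (hr : 0 < r) (hrs : r ≤ s) (hq : 0 ≤ q) {g : ℤ → ℤ}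
    (hg : MexProp s r q g) {a b k l z : ℤ} (hk : 0 ≤ k) (hl : 0 ≤ l)
    (heq : ∀ i, 0 ≤ i → g (a + (z + i) * s) = g (b + (z + i) * s))
    (ha : UU s r q k a = a + z * s) (hb : UU s r q l b = b + z * s) :
    HH s r q k a ≤ HH s r q l b := by
  by_contra hc
  push Not at hc
  have h0 := HH_bd hs hr hrs hq l b
  have h1 := val_high hs hr hrs hq hg hk (high_mk ha (by omega : 0 ≤ HH s r q l b) hc)
  have hu : TT s r q (l + 1) b = b + (z + HH s r q l b) * s := by rw [TT_eq, hb]; ring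
  have h2 := val_low hs hr hrs hq hg (by omega) (low_mk hu le_rfl (by have := LL_bd hs hr hrs hq (l + 1) b; omega))
  have h3 := heq (HH s r q l b) (by omega)
  rw [add_zero] at h2
  omega

theorem transfer (hs : 0 < s) (hr : 0 < r) (hrs : r ≤ s) (hq : 0 ≤ q) {g : ℤ → ℤ}
    (hg : MexProp s r q g) {w k : ℤ} (hk : 0 ≤ k) (hw : ∀ x, 0 ≤ x → g (x + w) = g x)
    (hT : TT s r q k w = w) (j : ℕ) :
    ∃ z, 0 ≤ z ∧ TT s r q (k + j) w = w + z * s ∧ TT s r q j 0 = 0 + z * s ∧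
      LL s r q (k + j) w = LL s r q j 0 ∧ HH s r q (k + j) w = HH s r q j 0 := by
  have step : ∀ (j : ℕ) (z : ℤ), 0 ≤ z → TT s r q (k + j) w = w + z * s →
      TT s r q j 0 = 0 + z * s →
      LL s r q (k + j) w = LL s r q j 0 ∧ HH s r q (k + j) w = HH s r q j 0 := by
    intro j z hz h1 h2
    have heq : ∀ z, 0 ≤ z → ∀ i, 0 ≤ i → g (w + (z + i) * s) = g (0 + (z + i) * s) := by
      intro z hz i hi
      rw [zero_add, add_comm w]
      exact hw _ (by positivity)
    have hkj : 0 ≤ k + j := by positivity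
    have hj : (0 : ℤ) ≤ j := by positivity
    have hL : LL s r q (k + j) w = LL s r q j 0 :=
      le_antisymm (LL_le hs hr hrs hq hg hkj hj (heq z hz) h1 h2)
        (LL_le hs hr hrs hq hg hj hkj (fun i hi => (heq z hz i hi).symm) h2 h1)
    have hz2 : 0 ≤ z + LL s r q j 0 := by have := LL_bd hs hr hrs hq j 0; omega
    have u1 : UU s r q (k + j) w = w + (z + LL s r q j 0) * s := by rw [UU_eq, hL, h1]; ring
    have u2 : UU s r q j 0 = 0 + (z + LL s r q j 0) * s := by rw [UU_eq, h2]; ring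
    exact ⟨hL, le_antisymm (HH_le hs hr hrs hq hg hkj hj (heq _ hz2) u1 u2)
        (HH_le hs hr hrs hq hg hj hkj (fun i hi => (heq _ hz2 i hi).symm) u2 u1)⟩
  induction j with
  | zero =>
    have h1 : TT s r q (k + (0 : ℕ)) w = w + 0 * s := by simp [hT]
    have h2 : TT s r q (0 : ℕ) 0 = 0 + 0 * s := by simp [TT, cc]
    exact ⟨0, le_rfl, h1, h2, step 0 0 le_rfl h1 h2⟩
  | succ j ih =>
    obtain ⟨z, hz, h1, h2, h3, h4⟩ := ih
    have l1 := LL_bd hs hr hrs hq j 0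
    have l2 := HH_bd hs hr hrs hq j 0
    have h1' : TT s r q (k + (j + 1 : ℕ)) w = w + (z + LL s r q j 0 + HH s r q j 0) * s := by
      push_cast
      rw [← add_assoc, TT_eq, UU_eq, h1, h3, h4]; ring
    have h2' : TT s r q (j + 1 : ℕ) 0 = 0 + (z + LL s r q j 0 + HH s r q j 0) * s := by
      push_cast
      rw [TT_eq, UU_eq, h2]; ring
    have hz' : 0 ≤ z + LL s r q j 0 + HH s r q j 0 := by omega
    exact ⟨_, hz', h1', h2', step _ _ hz' h1' h2'⟩

/-- equal carries from the point `0` force a small starting point -/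
theorem coding {d : ℤ} (hs : 0 < s) (hd : d = Int.gcd s r) {l w : ℤ}
    (h : ∀ j : ℕ, al s r (l + j) w = al s r j 0) : cc s r l w < d := by
  have key : ∀ j : ℕ, cc s r (l + j) w = cc s r l w + cc s r j 0 := by
    intro j
    induction j with
    | zero => simp [cc]
    | succ j ih =>
      push_cast
      rw [← add_assoc, cc_succ, cc_succ, h j, ih]; ring
  have hdpos : 0 < d := by
    rw [hd]; exact_mod_cast Int.gcd_pos_of_ne_zero_left r hs.ne'
  set x := cc s r l w with hx
  have hx0 : 0 ≤ x := (cc_bd hs l w).1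
  have hb := Int.gcd_eq_gcd_ab s r
  rw [← hd] at hb
  set u := Int.gcdA s r
  set v := Int.gcdB s r
  obtain ⟨n, hn⟩ := Int.eq_ofNat_of_zero_le (Int.emod_nonneg (-(v * (x / d))) hs.ne')
  have hk := key n
  have h0 := (cc_bd (r := r) hs n 0).1
  have hcn : cc s r (l + n) w = x % d := by
    have hds : d ≤ s := by
      apply Int.le_of_dvd hs; rw [hd]; exact Int.gcd_dvd_left ..
    have hlt : x % d < s := lt_of_lt_of_le (Int.emod_lt_of_pos _ hdpos) hds
    rw [← Int.emod_eq_of_lt (Int.emod_nonneg x hdpos.ne') hlt]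
    unfold cc
    apply Int.ModEq.symm
    apply (Int.modEq_iff_dvd).2
    have e1 : x = w + r * l - s * ((w + r * l) / s) := by
      rw [hx]; unfold cc; rw [Int.emod_def]
    have e2 : x % d = x - d * (x / d) := Int.emod_def _ _
    have e3 : (n : ℤ) = -(v * (x / d)) - s * (-(v * (x / d)) / s) := by
      rw [← Int.emod_def]; exact hn.symm
    refine ⟨(w + r * l) / s + u * (x / d) - r * (-(v * (x / d)) / s), ?_⟩
    rw [e2, e3]
    generalize -(v * (x / d)) / s = A
    generalize (w + r * l) / s = B at *
    generalize x / d = C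
    rw [e1, hb]; ring
  have hmod := Int.emod_lt_of_pos x hdpos
  omega

theorem period_ok (hs : 0 < s) (hr : 0 < r) (hrs : r ≤ s) (hq : 0 ≤ q) {g : ℤ → ℤ}
    (hg : MexProp s r q g) {d t e : ℤ} (ht : 0 < t) (h1 : s = d * t) (h2 : r = d * e) :
    (∀ x k i, Low s r q k i x → Low s r q (k + t) i (x + t * ((4 * q + 7) * s - 3 * r))) ∧
    ∀ x, 0 ≤ x → g (x + t * ((4 * q + 7) * s - 3 * r)) = g x := by
  have hQ : t * ((4 * q + 7) * s - 3 * r) = ((4 * q + 7) * t - 3 * e) * s := by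
    rw [h1, h2]; ring
  have hc : ∀ n m a, cc s r (n + m * t) a = cc s r n a := by
    intro n m a
    unfold cc
    rw [show a + r * (n + m * t) = a + r * n + s * (e * m) by rw [h1, h2]; ring,
      Int.add_mul_emod_self_left]
  have hc1 : ∀ n a, cc s r (n + t) a = cc s r n a := by
    intro n a; simpa using hc n 1 a
  have hc2 : ∀ n a, cc s r (2 * (n + t)) a = cc s r (2 * n) a := by
    intro n a; rw [← hc (2 * n) 2 a]; ring_nf
  have hc3 : ∀ n a, cc s r (2 * (n + t) + 1) a = cc s r (2 * n + 1) a := by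
    intro n a; rw [← hc (2 * n + 1) 2 a]; ring_nf
  have lo : ∀ x k i, Low s r q k i x → Low s r q (k + t) i (x + t * ((4 * q + 7) * s - 3 * r)) := by
    intro x k i h
    obtain ⟨a, b, c⟩ := h
    refine ⟨?_, b, ?_⟩
    · rw [hQ, TT_addz, ← hQ]
      unfold TT at a ⊢
      rw [hc1, hc2]; linarith
    · rw [hQ, LL_addz]
      unfold LL al at c ⊢
      rw [hc2]; exact c
  have hi : ∀ x k i, High s r q k i x → High s r q (k + t) i (x + t * ((4 * q + 7) * s - 3 * r)) := by
    intro x k i h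
    obtain ⟨a, b, c⟩ := h
    refine ⟨?_, b, ?_⟩
    · rw [hQ, UU_addz, ← hQ]
      unfold UU at a ⊢
      rw [hc1, hc3]; linarith
    · rw [hQ, HH_addz]
      unfold HH al at c ⊢
      rw [hc1, hc3]; exact c
  refine ⟨lo, ?_⟩
  intro x hx
  obtain ⟨k, i, hk, h | h⟩ := ex_block hs hr hrs hq hx
  · rw [val_low hs hr hrs hq hg hk h, val_low hs hr hrs hq hg (by omega) (lo _ _ _ h)]
  · rw [val_high hs hr hrs hq hg hk h, val_high hs hr hrs hq hg (by omega) (hi _ _ _ h)]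

theorem period_min (hs : 0 < s) (hr : 0 < r) (hrs : r ≤ s) (hq : 0 ≤ q) {g : ℤ → ℤ}
    (hg : MexProp s r q g) {d t e : ℤ} (ht : 0 < t) (h1 : s = d * t) (h2 : r = d * e)
    (hd : d = Int.gcd s r) {w : ℤ} (hw0 : 0 < w) (hw : ∀ x, 0 ≤ x → g (x + w) = g x) :
    t * ((4 * q + 7) * s - 3 * r) ≤ w := by
  obtain ⟨lo, hper⟩ := period_ok hs hr hrs hq hg ht h1 h2
  set P := (4 * q + 7) * s - 3 * r with hP
  have hPs : s ≤ P := by nlinarith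
  have hQs : s ≤ t * P := by nlinarith
  have hL0 : Low s r q 0 0 0 := ⟨by simp [TT, cc], le_rfl, by
    have := LL_bd hs hr hrs hq 0 0; omega⟩
  have g0 := val_low hs hr hrs hq hg le_rfl hL0
  have gw : g w = 0 := by
    have := hw 0 le_rfl
    rw [zero_add] at this; omega
  obtain ⟨k, i, hk, h | h⟩ := ex_block hs hr hrs hq hw0.le
  swap
  · have := val_high hs hr hrs hq hg hk h; omega
  have hi : i = 0 := by
    by_contra hi
    have hi1 : 1 ≤ i := by have := h.2.1; omega
    have b1 := val_low hs hr hrs hq hg (by omega) (low_pred (lo _ _ _ h) hi1)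
    have b2 := val_high hs hr hrs hq hg (by omega) (low_zero_pred hs hr hrs hq (lo _ _ _ hL0))
    have b3 := hw (0 + t * P - s) (by omega)
    rw [show 0 + t * P - s + w = w + t * P - s by ring] at b3
    omega
  subst hi
  have hT : TT s r q k w = w := by have := h.1; omega
  have tr := transfer hs hr hrs hq hg hk hw hT
  have ev : ∀ j : ℕ, al s r (2 * k + 2 * j) w = al s r (2 * j) 0 ∧
      al s r (2 * k + 2 * j + 1) w = al s r (2 * j + 1) 0 ∧ al s r (k + j) w = al s r j 0 := by
    intro j
    obtain ⟨z, _, _, _, e1, e2⟩ := tr j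
    unfold LL at e1
    unfold HH at e2
    rw [mul_add] at e1 e2
    have := al_bd hs hr hrs (2 * k + 2 * j + 1) w
    have := al_bd hs hr hrs (2 * j + 1) 0
    have := al_bd hs hr hrs (k + j) w
    have := al_bd hs hr hrs j 0
    omega
  have c1 : cc s r k w < d := coding hs hd (fun j => (ev j).2.2)
  have c2 : cc s r (2 * k) w < d := by
    apply coding hs hd
    intro j
    obtain ⟨m, hm | hm⟩ := Nat.even_or_odd' j
    · subst hm; push_cast; exact (ev m).1
    · subst hm; push_cast; rw [← add_assoc]; exact (ev m).2.1
  have b1 := cc_bd (r := r) hs k w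
  have b2 := cc_bd (r := r) hs (2 * k) w
  have e1 : cc s r k w = w + r * k - s * ((w + r * k) / s) := by unfold cc; rw [Int.emod_def]
  have e2 : cc s r (2 * k) w = w + r * (2 * k) - s * ((w + r * (2 * k)) / s) := by
    unfold cc; rw [Int.emod_def]
  set A := (w + r * k) / s
  set B := (w + r * (2 * k)) / s
  have hdpos : 0 < d := by omega
  have ediff : cc s r (2 * k) w - cc s r k w = d * (e * k - t * B + t * A) := by
    rw [e1, e2, h1, h2]; ring
  have ez : e * k - t * B + t * A = 0 := by
    have u1 : d * (e * k - t * B + t * A) < d * 1 := by omega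
    have u2 : d * (-1) < d * (e * k - t * B + t * A) := by omega
    have u1' := lt_of_mul_lt_mul_left u1 hdpos.le
    have u2' := lt_of_mul_lt_mul_left u2 hdpos.le
    omega
  rw [ez, mul_zero] at ediff
  have hcop : IsCoprime t e := by
    have hb := Int.gcd_eq_gcd_ab s r
    rw [← hd] at hb
    refine ⟨Int.gcdA s r, Int.gcdB s r, ?_⟩
    apply mul_left_cancel₀ hdpos.ne'
    generalize Int.gcdA s r = X at *
    generalize Int.gcdB s r = Y at *
    rw [h1, h2] at hb
    linarith
  have htk : t ∣ k := by
    apply hcop.dvd_of_dvd_mul_left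
    exact ⟨B - A, by linarith⟩
  have hwk : w = k * P + cc s r k w := by
    unfold TT at hT
    rw [← hP] at hT
    linarith
  by_cases hk0 : k = 0
  · exfalso
    have hds : d ≤ s := by nlinarith
    rw [hk0, zero_mul, zero_add, ← hk0] at hwk
    have hws : w < s := by omega
    have f0 : TT s r q 0 0 = 0 + 0 * s := by simp [TT, cc]
    have f1 := val_low hs hr hrs hq hg le_rfl (low_mk f0 (by norm_num : (0:ℤ) ≤ 1) (by
      have := LL_bd hs hr hrs hq 0 0; omega))
    have f2 : Low s r q 0 0 (s - w) := by
      refine ⟨?_, le_rfl, by have := LL_bd hs hr hrs hq 0 (s - w); omega⟩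
      unfold TT cc; simp only [mul_zero, zero_mul, add_zero]
      rw [Int.emod_eq_of_lt (by omega) (by omega)]; omega
    have f3 := val_low hs hr hrs hq hg le_rfl f2
    have f4 := hw (s - w) (by omega)
    rw [show s - w + w = 0 + (0 + 1) * s by ring] at f4
    omega
  · have : t ≤ k := Int.le_of_dvd (by omega) htk
    have : t * P ≤ k * P := mul_le_mul_of_nonneg_right this (by omega)
    omega
end

theorem grundy_mex (S : Finset ℕ) (h v : ℕ)
    (h1 : ∀ a ∈ S, 0 < a → a ≤ h → grundy S (h - a) ≠ v)
    (h2 : ∀ w < v, ∃ a ∈ S, 0 < a ∧ a ≤ h ∧ grundy S (h - a) = w) : grundy S h = v := by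
  rw [grundy]
  apply le_antisymm
  · apply Nat.sInf_le
    simp only [Set.mem_setOf_eq, Finset.mem_image, Finset.mem_attach, true_and, Subtype.exists,
      Finset.mem_filter, not_exists]
    intro a ⟨ha, hb, hc⟩
    exact h1 a ha hb hc
  · apply le_csInf
    · obtain ⟨n, hn⟩ := Infinite.exists_notMem_finset
        ((S.filter (fun s => 0 < s ∧ s ≤ h)).attach.image (fun s => grundy S (h - s.1)))
      exact ⟨n, hn⟩
    · intro n hn
      by_contra hlt
      push Not at hlt
      obtain ⟨a, ha, hb, hc, hd⟩ := h2 n hlt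
      apply hn
      simp only [Finset.mem_image, Finset.mem_attach, true_and, Subtype.exists,
        Finset.mem_filter]
      exact ⟨a, ⟨ha, hb, hc⟩, hd⟩

/-- Case I of the conjecture, subcase `s₁ ≤ j < 2s₁`: if `s₃ = s₁ + s₂` and
`j ≡ s₂ - s₁ (mod 2s₁)` with `s₁ ≤ j < 2s₁`, then the eventual period equals
`s₁ · (s₂ + s₃ + j - 2s₁) / gcd(s₁, 2s₁ - j)`. -/
theorem subtraction_game_period_caseI_large_j
    (s1 s2 s3 j p : ℕ) (h1 : 0 < s1) (h12 : s1 < s2) (h23 : s2 < s3)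
    (hsum : s3 = s1 + s2)
    (hj : (s2 - s1) % (2 * s1) = j) (hjge : s1 ≤ j) (hjlt : j < 2 * s1)
    (hp : IsEventualPeriod {s1, s2, s3} p) :
    p = s1 * (s2 + s3 + j - 2 * s1) / Nat.gcd s1 (2 * s1 - j) := by
  obtain ⟨q, hqq⟩ : ∃ q : ℕ, s2 - s1 = 2 * s1 * q + j :=
    ⟨(s2 - s1) / (2 * s1), by rw [← hj]; exact (Nat.div_add_mod _ _).symm⟩
  obtain ⟨r, hr⟩ : ∃ r : ℕ, r = 2 * s1 - j := ⟨_, rfl⟩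
  have hr0 : 0 < r := by omega
  have hrs : r ≤ s1 := by omega
  rw [← hr]
  have hs2 : (s2 : ℤ) = (2 * (q : ℤ) + 3) * s1 - r := by
    have : s2 + r = 2 * s1 * q + 3 * s1 := by omega
    have : (s2 : ℤ) + r = 2 * s1 * q + 3 * s1 := by exact_mod_cast this
    linarith
  set S : Finset ℕ := {s1, s2, s3} with hS
  let g : ℤ → ℤ := fun x => (grundy S x.toNat : ℤ)
  have gnat : ∀ n : ℕ, g n = grundy S n := fun n => by simp [g]
  have gsub : ∀ (x : ℕ) (a : ℕ), a ≤ x → g ((x : ℤ) - a) = grundy S (x - a) := by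
    intro x a ha
    rw [← gnat, Nat.cast_sub ha]
  have hg : MexProp (s1 : ℤ) r q g := by
    intro x v hx hv c1 c2 c3 c4
    rw [← hs2] at c2 c3 c4
    obtain ⟨x, rfl⟩ := Int.eq_ofNat_of_zero_le hx
    obtain ⟨v, rfl⟩ := Int.eq_ofNat_of_zero_le hv
    have e3 : (x : ℤ) - s2 - s1 = (x : ℤ) - s3 := by rw [hsum]; push_cast; ring
    rw [e3] at c3 c4
    rw [gnat]
    congr 1
    apply grundy_mex
    · intro a ha ha0 hax heq
      have := gsub x a hax
      rw [heq] at this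
      rw [hS] at ha
      simp only [Finset.mem_insert, Finset.mem_singleton] at ha
      rcases ha with rfl | rfl | rfl
      · exact c1 (by omega) this
      · exact c2 (by omega) this
      · exact c3 (by omega) this
    · intro w hw
      rcases c4 w (by omega) (by omega) with ⟨ha, hb⟩ | ⟨ha, hb⟩ | ⟨ha, hb⟩
      · have hle : s1 ≤ x := by omega
        rw [gsub _ _ hle] at hb
        exact ⟨s1, by simp [hS], by omega, hle, by exact_mod_cast hb⟩
      · have hle : s2 ≤ x := by omega
        rw [gsub _ _ hle] at hb
        exact ⟨s2, by simp [hS], by omega, hle, by exact_mod_cast hb⟩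
      · have hle : s3 ≤ x := by omega
        rw [gsub _ _ hle] at hb
        exact ⟨s3, by simp [hS], by omega, hle, by exact_mod_cast hb⟩
  have hdpos : 0 < Nat.gcd s1 r := Nat.gcd_pos_of_pos_left _ h1
  obtain ⟨t, ht⟩ := Nat.gcd_dvd_left s1 r
  obtain ⟨e, he⟩ := Nat.gcd_dvd_right s1 r
  have hd : ((Nat.gcd s1 r : ℕ) : ℤ) = Int.gcd (s1 : ℤ) (r : ℤ) := by simp [Int.gcd]
  set d := Nat.gcd s1 r with hdd
  have ht0 : 0 < t := by
    rcases Nat.eq_zero_or_pos t with h | h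
    · rw [h] at ht; omega
    · exact h
  set P := s2 + s3 + j - 2 * s1 with hP
  have hPZ : (P : ℤ) = (4 * (q : ℤ) + 7) * s1 - 3 * r := by
    have : P + r = 2 * s2 + s1 := by omega
    have : (P : ℤ) + r = 2 * s2 + s1 := by exact_mod_cast this
    linarith
  have hP0 : 0 < P := by omega
  have hfin : s1 * P / d = t * P := by
    rw [ht, mul_assoc, Nat.mul_div_cancel_left _ hdpos]
  rw [hfin]
  have hsZ : (s1 : ℤ) = (d : ℤ) * t := by exact_mod_cast ht
  have hrZ : (r : ℤ) = (d : ℤ) * e := by exact_mod_cast he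
  have hsp : (0 : ℤ) < s1 := by exact_mod_cast h1
  have hrp : (0 : ℤ) < r := by exact_mod_cast hr0
  have hrsZ : (r : ℤ) ≤ s1 := by exact_mod_cast hrs
  have hqZ : (0 : ℤ) ≤ q := by positivity
  have htZ : (0 : ℤ) < t := by exact_mod_cast ht0
  have hper := (period_ok hsp hrp hrsZ hqZ hg htZ hsZ hrZ).2
  rw [← hPZ] at hper
  have hperN : ∀ h : ℕ, grundy S (h + t * P) = grundy S h := by
    intro h
    have := hper h (by positivity)
    rw [gnat] at this
    have e : ((h : ℤ) + t * P) = ((h + t * P : ℕ) : ℤ) := by push_cast; ring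
    rw [e, gnat] at this
    exact_mod_cast this
  have hperM : ∀ n h : ℕ, grundy S (h + n * (t * P)) = grundy S h := by
    intro n
    induction n with
    | zero => intro h; simp
    | succ n ih => intro h; rw [add_mul, one_mul, ← add_assoc, hperN, ih]
  obtain ⟨⟨hp0, N, hN⟩, hmin⟩ := hp
  have htP : 0 < t * P := Nat.mul_pos ht0 hP0
  apply le_antisymm
  · exact hmin ⟨htP, 0, fun h _ => hperN h⟩
  · have hw : ∀ x : ℤ, 0 ≤ x → g (x + p) = g x := by
      intro x hx
      obtain ⟨x, rfl⟩ := Int.eq_ofNat_of_zero_le hx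
      have e : ((x : ℤ) + p) = ((x + p : ℕ) : ℤ) := by push_cast; ring
      rw [e, gnat, gnat]
      congr 1
      rw [← hperM N (x + p), ← hperM N x, ← hN (x + N * (t * P)) (le_trans (Nat.le_mul_of_pos_right N htP) (Nat.le_add_left _ _))]
      congr 1; ring
    have := period_min hsp hrp hrsZ hqZ hg htZ hsZ hrZ hd (by exact_mod_cast hp0) hw
    rw [← hPZ] at this
    exact_mod_cast this
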